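/- Let X be a bounded-below bigraded R-module and let d be an R-linear map of degree −1 on the total object CX with d∘d = 0 that is compatible with the column filtration (d(F_p(CX)) ⊆ F_p(CX) for all p). Then the components d^i : X_{p,q} → X_{p-i,q+i-1} of d (i = 0,1,2,…, obtained from the direct-sum decomposition of CX) satisfy Σ_{i+j=n} d^i d^j = 0 for every n ≥ 0, so they endow X with the structure of a multicomplex, and totalization of the family {d^i} recovers the original differential d. -/

import Mathlib

/-!
Framework: a bigraded `R`-module is a family `X : ℤ × ℤ → Type` of `R`-modules;
its total object is the direct sum `⨁ pq, X pq`.  A (column-filtration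
preserving) multimorphism of degree `η` is a family `f : ℕ → _` of linear maps
of total objects, `f k` being the component of bidegree `(-k, k + η)`.
-/

open scoped DirectSum

section MultiPreamble

variable {R : Type} [CommRing R]
variable {X Y Z : ℤ × ℤ → Type}
variable [∀ pq, AddCommGroup (X pq)] [∀ pq, Module R (X pq)]
variable [∀ pq, AddCommGroup (Y pq)] [∀ pq, Module R (Y pq)]
variable [∀ pq, AddCommGroup (Z pq)] [∀ pq, Module R (Z pq)]

/-- `F` maps the `(p,q)`-component of the total object into the `(p+a, q+b)`-component. -/
def IsBidegree (a b : ℤ) (F : (⨁ pq, X pq) →ₗ[R] ⨁ pq, Y pq) : Prop :=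
  ∀ (pq : ℤ × ℤ) (x : X pq) (pq' : ℤ × ℤ), pq' ≠ (pq.1 + a, pq.2 + b) →
    F (DirectSum.lof R (ℤ × ℤ) X pq x) pq' = 0

/-- Convolution composition of multimorphisms: `(g ∘ f)^k = ∑_{i+j=k} g^i f^j`. -/
def conv (g : ℕ → ((⨁ pq, Y pq) →ₗ[R] ⨁ pq, Z pq))
    (f : ℕ → ((⨁ pq, X pq) →ₗ[R] ⨁ pq, Y pq)) :
    ℕ → ((⨁ pq, X pq) →ₗ[R] ⨁ pq, Z pq) :=
  fun k => ∑ i ∈ Finset.range (k + 1), (g i).comp (f (k - i))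

/-- The identity multimorphism. -/
def idmm (R : Type) [CommRing R] (X : ℤ × ℤ → Type) [∀ pq, AddCommGroup (X pq)]
    [∀ pq, Module R (X pq)] : ℕ → ((⨁ pq, X pq) →ₗ[R] ⨁ pq, X pq) :=
  fun k => if k = 0 then LinearMap.id else 0

/-- Bounded below: for each total degree `n` the columns vanish far to the left. -/
def BoundedBelow (X : ℤ × ℤ → Type) [∀ pq, AddCommGroup (X pq)] : Prop :=
  ∀ n : ℤ, ∃ s : ℤ, ∀ pq : ℤ × ℤ, pq.1 + pq.2 = n → pq.1 < s → ∀ x : X pq, x = 0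

/-- The bidegree-`(a,b)` component of a linear map of total objects. -/
noncomputable def component' (a b : ℤ) (F : (⨁ pq, X pq) →ₗ[R] ⨁ pq, Y pq) :
    (⨁ pq, X pq) →ₗ[R] ⨁ pq, Y pq :=
  DirectSum.toModule R (ℤ × ℤ) _ fun pq =>
    (DirectSum.lof R (ℤ × ℤ) Y (pq.1 + a, pq.2 + b)).comp
      ((DirectSum.component R (ℤ × ℤ) Y (pq.1 + a, pq.2 + b)).comp
        (F.comp (DirectSum.lof R (ℤ × ℤ) X pq)))

/-- Totalization of a multimorphism (pointwise, a finite sum in each argument when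
the modules are bounded below). -/
noncomputable def totalize (f : ℕ → ((⨁ pq, X pq) →ₗ[R] ⨁ pq, Y pq)) :
    (⨁ pq, X pq) → ⨁ pq, Y pq :=
  fun x => ∑ᶠ k, f k x

/-- A multicomplex structure (multidifferential) on `X`. -/
def IsMulticomplex (d : ℕ → ((⨁ pq, X pq) →ₗ[R] ⨁ pq, X pq)) : Prop :=
  (∀ i : ℕ, IsBidegree (-(i : ℤ)) ((i : ℤ) - 1) (d i)) ∧
  ∀ n, ∑ i ∈ Finset.range (n + 1), (d i).comp (d (n - i)) = 0

/-- A morphism of multicomplexes. -/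
def IsMCMorphism (dX : ℕ → ((⨁ pq, X pq) →ₗ[R] ⨁ pq, X pq))
    (dY : ℕ → ((⨁ pq, Y pq) →ₗ[R] ⨁ pq, Y pq))
    (f : ℕ → ((⨁ pq, X pq) →ₗ[R] ⨁ pq, Y pq)) : Prop :=
  (∀ k : ℕ, IsBidegree (-(k : ℤ)) (k : ℤ) (f k)) ∧
  ∀ k, ∑ i ∈ Finset.range (k + 1), (dY i).comp (f (k - i)) =
    ∑ i ∈ Finset.range (k + 1), (f i).comp (dX (k - i))

/-- A multihomotopy from `φ` to `ψ`; `H k` encodes the component `h^{k-1}` (so that the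
component `h^{-1}` is allowed). -/
def IsMultihomotopy (dX : ℕ → ((⨁ pq, X pq) →ₗ[R] ⨁ pq, X pq))
    (dY : ℕ → ((⨁ pq, Y pq) →ₗ[R] ⨁ pq, Y pq))
    (φ ψ H : ℕ → ((⨁ pq, X pq) →ₗ[R] ⨁ pq, Y pq)) : Prop :=
  (∀ k : ℕ, IsBidegree (1 - (k : ℤ)) (k : ℤ) (H k)) ∧
  ∀ m, ∑ i ∈ Finset.range (m + 1), ((dY i).comp (H (m - i)) + (H i).comp (dX (m - i))) =
    if m = 0 then 0 else ψ (m - 1) - φ (m - 1)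

/-- Lying in the `q`-th column filtration level of the total object. -/
def InColFil (q : ℤ) (x : ⨁ pq, X pq) : Prop := ∀ pq : ℤ × ℤ, q < pq.1 → x pq = 0

/-- The totalization of `f` restricts, on every column filtration level, to a
homology isomorphism (a filtered quasi-isomorphism of total complexes). -/
def InducesColHomologyIso (dX : ℕ → ((⨁ pq, X pq) →ₗ[R] ⨁ pq, X pq))
    (dY : ℕ → ((⨁ pq, Y pq) →ₗ[R] ⨁ pq, Y pq))
    (f : ℕ → ((⨁ pq, X pq) →ₗ[R] ⨁ pq, Y pq)) : Prop :=
  ∀ q : ℤ,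
    (∀ y : ⨁ pq, Y pq, InColFil q y → totalize dY y = 0 →
      ∃ (x : ⨁ pq, X pq) (z : ⨁ pq, Y pq), InColFil q x ∧ InColFil q z ∧
        totalize dX x = 0 ∧ y = totalize f x + totalize dY z) ∧
    (∀ x : ⨁ pq, X pq, InColFil q x → totalize dX x = 0 →
      (∃ z : ⨁ pq, Y pq, InColFil q z ∧ totalize f x = totalize dY z) →
      ∃ w : ⨁ pq, X pq, InColFil q w ∧ x = totalize dX w)

end MultiPreamble

section ComponentLemmas

variable {R : Type} [CommRing R] {X Y : ℤ × ℤ → Type}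
variable [∀ pq, AddCommGroup (X pq)] [∀ pq, Module R (X pq)]
variable [∀ pq, AddCommGroup (Y pq)] [∀ pq, Module R (Y pq)]

theorem component'_lof (a b : ℤ) (F : (⨁ pq, X pq) →ₗ[R] ⨁ pq, Y pq) (s : ℤ × ℤ) (x : X s) :
    component' a b F (DirectSum.lof R (ℤ × ℤ) X s x) =
      DirectSum.lof R (ℤ × ℤ) Y (s.1 + a, s.2 + b)
        (F (DirectSum.lof R (ℤ × ℤ) X s x) (s.1 + a, s.2 + b)) := by
  rw [component', DirectSum.toModule_lof]
  rfl

theorem component'_lof_apply_self (a b : ℤ) (F : (⨁ pq, X pq) →ₗ[R] ⨁ pq, Y pq)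
    (s : ℤ × ℤ) (x : X s) (r : ℤ × ℤ) (hr : r = (s.1 + a, s.2 + b)) :
    component' a b F (DirectSum.lof R (ℤ × ℤ) X s x) r =
      F (DirectSum.lof R (ℤ × ℤ) X s x) r := by
  subst hr
  rw [component'_lof]
  exact DirectSum.of_eq_same _ _

theorem isBidegree_component' (a b : ℤ) (F : (⨁ pq, X pq) →ₗ[R] ⨁ pq, Y pq) :
    IsBidegree a b (component' a b F) := by
  intro s x r hr
  rw [component'_lof]
  exact DirectSum.of_eq_of_ne _ _ _ hr

/-- A composite of homogeneous maps agrees, in its target bidegree, with the composite in which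
the outer map is not yet projected to its component. -/
theorem component'_comp_component'_lof_apply (a b a' b' : ℤ)
    (G : (⨁ pq, Y pq) →ₗ[R] ⨁ pq, Y pq) (F : (⨁ pq, X pq) →ₗ[R] ⨁ pq, Y pq)
    (s : ℤ × ℤ) (x : X s) (r : ℤ × ℤ) (hr : r = (s.1 + a' + a, s.2 + b' + b)) :
    component' a b G (component' a' b' F (DirectSum.lof R (ℤ × ℤ) X s x)) r =
      G (component' a' b' F (DirectSum.lof R (ℤ × ℤ) X s x)) r := by
  rw [component'_lof]
  exact component'_lof_apply_self a b G _ _ r hr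

theorem component'_comp_component'_lof_apply_of_ne (a b a' b' : ℤ)
    (G : (⨁ pq, Y pq) →ₗ[R] ⨁ pq, Y pq) (F : (⨁ pq, X pq) →ₗ[R] ⨁ pq, Y pq)
    (s : ℤ × ℤ) (x : X s) (r : ℤ × ℤ) (hr : r ≠ (s.1 + a' + a, s.2 + b' + b)) :
    component' a b G (component' a' b' F (DirectSum.lof R (ℤ × ℤ) X s x)) r = 0 := by
  rw [component'_lof]
  exact isBidegree_component' a b G _ _ r hr

/-- Only finitely many components of a map are nonzero on a given element. -/
theorem finite_support_component' (η : ℤ) (F : (⨁ pq, X pq) →ₗ[R] ⨁ pq, Y pq) (x : ⨁ pq, X pq) :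
    (Function.support fun k : ℕ => component' (-(k : ℤ)) ((k : ℤ) + η) F x).Finite := by
  classical
  induction x using DirectSum.induction_on with
  | zero => simp
  | of s x =>
    have hinj : Function.Injective fun k : ℕ => (s.1 + -(k : ℤ), s.2 + ((k : ℤ) + η)) := by
      intro k l h
      simpa using congrArg Prod.fst h
    refine ((DFinsupp.finite_support
      (F (DirectSum.lof R (ℤ × ℤ) X s x))).preimage hinj.injOn).subset ?_
    intro k hk h
    refine hk ?_
    have h' : F (DirectSum.lof R (ℤ × ℤ) X s x) (s.1 + -(k : ℤ), s.2 + ((k : ℤ) + η)) = 0 := h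
    change component' (-(k : ℤ)) ((k : ℤ) + η) F (DirectSum.lof R (ℤ × ℤ) X s x) = 0
    rw [component'_lof, h', map_zero]
  | add x y hx hy =>
    refine (hx.union hy).subset ?_
    simp only [map_add]
    exact Function.support_add _ _

/-- A filtration-preserving map of degree `η` is the totalization of its components. -/
theorem totalize_component' (η : ℤ) (F : (⨁ pq, X pq) →ₗ[R] ⨁ pq, Y pq)
    (hdeg : ∀ (s : ℤ × ℤ) (x : X s) (r : ℤ × ℤ), r.1 + r.2 ≠ s.1 + s.2 + η →
      F (DirectSum.lof R (ℤ × ℤ) X s x) r = 0)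
    (hfil : ∀ (s : ℤ × ℤ) (x : X s) (r : ℤ × ℤ), s.1 < r.1 →
      F (DirectSum.lof R (ℤ × ℤ) X s x) r = 0) (x : ⨁ pq, X pq) :
    totalize (fun k : ℕ => component' (-(k : ℤ)) ((k : ℤ) + η) F) x = F x := by
  classical
  unfold totalize
  induction x using DirectSum.induction_on with
  | zero => simp
  | of s x =>
    change ∑ᶠ k : ℕ, component' (-(k : ℤ)) ((k : ℤ) + η) F (DirectSum.lof R (ℤ × ℤ) X s x) =
      F (DirectSum.lof R (ℤ × ℤ) X s x)
    refine DFinsupp.ext fun r => ?_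
    have hmap := (DirectSum.component R (ℤ × ℤ) Y r).toAddMonoidHom.map_finsum
      (finite_support_component' η F (DirectSum.lof R (ℤ × ℤ) X s x))
    refine hmap.trans ?_
    change ∑ᶠ k : ℕ, component' (-(k : ℤ)) ((k : ℤ) + η) F (DirectSum.lof R (ℤ × ℤ) X s x) r = _
    by_cases hr : ∃ k : ℕ, r = (s.1 + -(k : ℤ), s.2 + ((k : ℤ) + η))
    · obtain ⟨k, hk⟩ := hr
      rw [finsum_eq_single _ k, component'_lof_apply_self _ _ _ _ _ _ hk]
      intro l hl
      refine isBidegree_component' _ _ F s x r fun h => hl ?_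
      have := congrArg Prod.fst (hk.symm.trans h)
      simp only at this
      omega
    · push Not at hr
      rw [finsum_eq_zero_of_forall_eq_zero
        fun k => isBidegree_component' _ _ F s x r (hr k)]
      symm
      by_cases h1 : s.1 < r.1
      · exact hfil s x r h1
      · refine hdeg s x r fun h2 => hr (s.1 - r.1).toNat ?_
        ext <;> simp only <;> omega
  | add x y hx hy =>
    simp only [map_add]
    rw [finsum_add_distrib (finite_support_component' η F x) (finite_support_component' η F y),
      hx, hy]

end ComponentLemmas

/-- Proposition 1.5.  If `d` is a square-zero differential of degree `-1`
on the total object of a bounded-below bigraded `R`-module `X` which is compatible with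
the column filtration, then its components `d^i : X_{p,q} → X_{p-i,q+i-1}` endow `X`
with a multicomplex structure whose totalization recovers `d`. -/
theorem minimal_multi_models_stmt2 (R : Type) [CommRing R] (X : ℤ × ℤ → Type)
    [∀ pq, AddCommGroup (X pq)] [∀ pq, Module R (X pq)]
    (hX : BoundedBelow X)
    (d : (⨁ pq, X pq) →ₗ[R] ⨁ pq, X pq)
    (hdeg : ∀ (pq : ℤ × ℤ) (x : X pq) (pq' : ℤ × ℤ), pq'.1 + pq'.2 ≠ pq.1 + pq.2 - 1 →
      d (DirectSum.lof R (ℤ × ℤ) X pq x) pq' = 0)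
    (hsq : d.comp d = 0)
    (hfil : ∀ (pq : ℤ × ℤ) (x : X pq) (pq' : ℤ × ℤ), pq.1 < pq'.1 →
      d (DirectSum.lof R (ℤ × ℤ) X pq x) pq' = 0) :
    IsMulticomplex (fun i => component' (-(i : ℤ)) ((i : ℤ) - 1) d) ∧
      ∀ x : ⨁ pq, X pq, totalize (fun i => component' (-(i : ℤ)) ((i : ℤ) - 1) d) x = d x := by
  have htot : ∀ x : ⨁ pq, X pq,
      totalize (fun i => component' (-(i : ℤ)) ((i : ℤ) - 1) d) x = d x := by
    simpa only [← sub_eq_add_neg] using totalize_component' (-1) d hdeg hfil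
  refine ⟨⟨fun i => isBidegree_component' _ _ d, fun n => ?_⟩, htot⟩
  refine DirectSum.linearMap_ext R fun s => LinearMap.ext fun x => DFinsupp.ext fun r => ?_
  set u := DirectSum.lof R (ℤ × ℤ) X s x with hu
  let c : ℕ → (⨁ pq, X pq) →ₗ[R] ⨁ pq, X pq := fun k => component' (-(k : ℤ)) ((k : ℤ) - 1) d
  let π := DirectSum.component R (ℤ × ℤ) X r
  change π ((∑ i ∈ Finset.range (n + 1), (c i).comp (c (n - i))) u) = 0
  simp only [LinearMap.sum_apply, map_sum, LinearMap.comp_apply]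
  by_cases hr : r = (s.1 - n, s.2 + n - 2)
  · have hfin : (Function.support fun k => c k u).Finite := by
      simpa only [← sub_eq_add_neg] using finite_support_component' (-1) d u
    have hdd : ∑ᶠ k, π (d (c k u)) = 0 := by
      have hmap := (π.comp d).toAddMonoidHom.map_finsum hfin
      refine hmap.symm.trans ?_
      change π (d (totalize c u)) = 0
      rw [htot u, ← LinearMap.comp_apply d d, hsq, LinearMap.zero_apply, map_zero]
    rw [finsum_eq_sum_of_support_subset (s := Finset.range (n + 1)) _ ?_] at hdd
    · rw [← Finset.sum_flip] at hdd
      refine (Finset.sum_congr rfl fun i hi => ?_).trans hdd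
      have hin : i ≤ n := Nat.lt_succ_iff.mp (Finset.mem_range.mp hi)
      refine component'_comp_component'_lof_apply _ _ _ _ d d s x r ?_
      rw [hr]
      ext <;> simp only <;> omega
    · intro k hk
      by_contra hkn
      refine hk ?_
      simp only [Finset.coe_range, Set.mem_Iio] at hkn
      change d (component' (-(k : ℤ)) ((k : ℤ) - 1) d u) r = 0
      rw [hu, component'_lof]
      refine hfil _ _ r ?_
      rw [hr]
      simp only
      omega
  · refine Finset.sum_eq_zero fun i hi => ?_
    have hin : i ≤ n := Nat.lt_succ_iff.mp (Finset.mem_range.mp hi)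
    refine component'_comp_component'_lof_apply_of_ne _ _ _ _ d d s x r fun h => hr ?_
    rw [h]
    ext <;> simp only <;> omega
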